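/- arXiv:1306.1841 — 2 statements merged into one kernel-verified Lean document; each statement's English description precedes it below -/
import Mathlib

section
/- Let n ≥ 2, let ω₁ be a positive continuous A₁ weight on ℝⁿ, let ω₂ be a positive continuous strong A∞ weight on ℝⁿ (i.e. ω₂ is an A_q weight for some q > 1 and there is C₂ with C₂^{−1} δ_{ω₂}(x,y) ≤ d_{ω₂}(x,y) ≤ C₂ δ_{ω₂}(x,y) for all x, y), and let r > 0. If the product ω := ω₁^r ω₂ is an A_p weight for some p > 1, then ω is a strong A∞ weight: there exists C with C^{−1} δ_ω(x,y) ≤ d_ω(x,y) ≤ C δ_ω(x,y) for all x, y ∈ ℝⁿ. -/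
open MeasureTheory Metric Set
open scoped ENNReal

/-- `c_n := 2^{n-2} Γ(n/2) π^{n/2}`. -/
noncomputable def cN (n : ℕ) : ℝ :=
  (2 : ℝ) ^ ((n : ℝ) - 2) * Real.Gamma ((n : ℝ) / 2) * Real.pi ^ ((n : ℝ) / 2)

/-- Logarithmic potential `u(x) = (1/c_n) ∫ log(|y|/|x-y|) f(y) dy`. -/
noncomputable def logPot (n : ℕ) (f : EuclideanSpace ℝ (Fin n) → ℝ)
    (x : EuclideanSpace ℝ (Fin n)) : ℝ :=
  (1 / cN n) * ∫ y, Real.log (‖y‖ / ‖x - y‖) * f y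

/-- `ω` is an `A_p` weight with constant `K` (for `p > 1`):
for every ball `B`, `(⨍_B ω) · (⨍_B ω^{-1/(p-1)})^{p-1} ≤ K`. -/
def IsApWeight (n : ℕ) (p K : ℝ) (ω : EuclideanSpace ℝ (Fin n) → ℝ) : Prop :=
  ∀ (x : EuclideanSpace ℝ (Fin n)) (r : ℝ), 0 < r →
    ((volume (ball x r)).toReal⁻¹ * ∫ y in ball x r, ω y) *
      ((volume (ball x r)).toReal⁻¹ *
        ∫ y in ball x r, (ω y) ^ (-(1 / (p - 1)) : ℝ)) ^ (p - 1) ≤ K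

/-- `δ_ω(x,y) = (∫_{B_{xy}} ω)^{1/n}`, where `B_{xy}` is the closed ball with
center `(x+y)/2` and radius `|x-y|/2`. -/
noncomputable def deltaW (n : ℕ) (ω : EuclideanSpace ℝ (Fin n) → ℝ)
    (x y : EuclideanSpace ℝ (Fin n)) : ℝ :=
  (∫ z in closedBall (midpoint ℝ x y) (dist x y / 2), ω z) ^ ((1 : ℝ) / n)

/-- `d_ω(x,y)`: infimum of `∫₀^L ω(γ(t))^{1/n} dt` over all `L ≥ 0` and all
1-Lipschitz curves `γ : [0,L] → ℝⁿ` joining `x` to `y` inside `B_{xy}`. -/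
noncomputable def dW (n : ℕ) (ω : EuclideanSpace ℝ (Fin n) → ℝ)
    (x y : EuclideanSpace ℝ (Fin n)) : ℝ :=
  sInf {d : ℝ | ∃ (L : ℝ) (γ : ℝ → EuclideanSpace ℝ (Fin n)),
    0 ≤ L ∧ LipschitzOnWith 1 γ (Set.Icc 0 L) ∧ γ 0 = x ∧ γ L = y ∧
    (∀ t ∈ Set.Icc 0 L, γ t ∈ closedBall (midpoint ℝ x y) (dist x y / 2)) ∧
    d = ∫ t in (0 : ℝ)..L, (ω (γ t)) ^ ((1 : ℝ) / n)}

/-- One-dimensional Hausdorff content: infimum of `Σᵢ diam Bᵢ` over countable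
covers of `E` by balls `Bᵢ`. -/
noncomputable def H1content {n : ℕ} (E : Set (EuclideanSpace ℝ (Fin n))) : ℝ≥0∞ :=
  ⨅ (c : ℕ → EuclideanSpace ℝ (Fin n) × ℝ) (_ : E ⊆ ⋃ i, ball (c i).1 (c i).2),
    ∑' i, ENNReal.ofReal (2 * (c i).2)


abbrev EE (n : ℕ) := EuclideanSpace ℝ (Fin n)

lemma int_on {n : ℕ} {f : EE n → ℝ} (hf : Continuous f) (c : EE n) (ρ : ℝ) :
    IntegrableOn f (ball c ρ) :=
  (hf.continuousOn.integrableOn_compact (isCompact_closedBall c ρ)).mono_set ball_subset_closedBall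

lemma memLp_on {n : ℕ} {f : EE n → ℝ} (hf : Continuous f) (c : EE n) (ρ : ℝ) (F : Set (EE n))
    (hF : MeasurableSet F) (hFB : F ⊆ ball c ρ) (p : ℝ≥0∞) :
    MemLp f p (volume.restrict F) := by
  obtain ⟨M, hM⟩ := (isCompact_closedBall c ρ).exists_bound_of_continuousOn hf.continuousOn
  have : IsFiniteMeasure (volume.restrict F) :=
    ⟨by simpa using (measure_mono hFB).trans_lt measure_ball_lt_top⟩
  refine MemLp.of_bound hf.aestronglyMeasurable M ?_
  filter_upwards [ae_restrict_mem hF] with z hz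
  exact hM z (ball_subset_closedBall (hFB hz))

lemma rpow_cont {n : ℕ} {f : EE n → ℝ} (hf : Continuous f) (hpos : ∀ x, 0 < f x) (s : ℝ) :
    Continuous (fun x => f x ^ s) :=
  hf.rpow_const (fun x => Or.inl (hpos x).ne')

lemma ap_subset {n : ℕ} {p K : ℝ} (hp : 1 < p) {ω : EE n → ℝ} (hc : Continuous ω)
    (hpos : ∀ x, 0 < ω x) (hAp : IsApWeight n p K ω) (c : EE n) {ρ : ℝ} (hρ : 0 < ρ)
    (F : Set (EE n)) (hF : MeasurableSet F) (hFB : F ⊆ ball c ρ)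
    (hFv : volume.real (ball c ρ) / 2 ≤ volume.real F) :
    (∫ z in ball c ρ, ω z) ≤ (2 : ℝ) ^ p * K * ∫ z in F, ω z := by
  set V := volume.real (ball c ρ) with hV
  have hVpos : 0 < V := ENNReal.toReal_pos (measure_ball_pos _ _ hρ).ne' measure_ball_lt_top.ne
  set σ : EE n → ℝ := fun y => (ω y) ^ (-(1 / (p - 1)) : ℝ) with hσ
  have hσc : Continuous σ := rpow_cont hc hpos _
  have hσpos : ∀ x, 0 < σ x := fun x => Real.rpow_pos_of_pos (hpos x) _
  have h := hAp c ρ hρ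
  change (V⁻¹ * ∫ y in ball c ρ, ω y) * (V⁻¹ * ∫ y in ball c ρ, σ y) ^ (p - 1) ≤ K at h
  set A := ∫ y in ball c ρ, ω y with hA
  set a := ∫ y in F, ω y with ha
  set S := ∫ y in ball c ρ, σ y with hS
  have hp0 : 0 < p - 1 := by linarith
  have hpp : 0 < p := by linarith
  have hpq : p.HolderConjugate (p / (p - 1)) := by
    rw [Real.holderConjugate_iff]; constructor
    · exact hp
    · field_simp; ring
  have hol := integral_mul_le_Lp_mul_Lq_of_nonneg (μ := volume.restrict F) hpq
    (f := fun z => ω z ^ (1 / p)) (g := fun z => ω z ^ (-(1 / p)))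
    (Filter.Eventually.of_forall fun z => (Real.rpow_pos_of_pos (hpos z) _).le)
    (Filter.Eventually.of_forall fun z => (Real.rpow_pos_of_pos (hpos z) _).le)
    (memLp_on (rpow_cont hc hpos _) c ρ F hF hFB _)
    (memLp_on (rpow_cont hc hpos _) c ρ F hF hFB _)
  have e1 : ∀ z, ω z ^ (1 / p) * ω z ^ (-(1 / p)) = 1 := by
    intro z; rw [← Real.rpow_add (hpos z)]; simp
  have e2 : ∀ z, (ω z ^ (1 / p)) ^ p = ω z := by
    intro z; rw [← Real.rpow_mul (hpos z).le]; field_simp; simp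
  have e3 : ∀ z, (ω z ^ (-(1 / p))) ^ (p / (p - 1)) = σ z := by
    intro z; rw [← Real.rpow_mul (hpos z).le, hσ]; congr 1; field_simp
  simp only [e1, e2, e3] at hol
  rw [← ha] at hol
  have ha0 : 0 ≤ a := integral_nonneg fun z => (hpos z).le
  have hA0 : 0 ≤ A := integral_nonneg fun z => (hpos z).le
  have hS0 : 0 ≤ S := integral_nonneg fun z => (hσpos z).le
  have hs0 : 0 ≤ ∫ y in F, σ y := integral_nonneg fun z => (hσpos z).le
  have hsS : ∫ y in F, σ y ≤ S :=
    setIntegral_mono_set (int_on hσc c ρ)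
      (Filter.Eventually.of_forall fun z => (hσpos z).le) hFB.eventuallyLE
  have hl : V / 2 ≤ a ^ (1 / p) * S ^ (1 / (p / (p - 1))) := by
    refine hFv.trans (le_trans ?_ (hol.trans ?_))
    · simp
    · gcongr
  have hl2 : (V / 2) ^ p ≤ a * S ^ (p - 1) := by
    calc (V / 2) ^ p ≤ (a ^ (1 / p) * S ^ (1 / (p / (p - 1)))) ^ p := by gcongr
      _ = a * S ^ (p - 1) := by
        rw [Real.mul_rpow (by positivity) (by positivity), ← Real.rpow_mul ha0,
          ← Real.rpow_mul hS0]
        congr 1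
        · field_simp; simp
        · congr 1; field_simp
  set T := (V⁻¹ * S) ^ (p - 1) with hT
  have hT0 : 0 ≤ T := by positivity
  have hST : S ^ (p - 1) = V ^ (p - 1) * T := by
    rw [hT, ← Real.mul_rpow hVpos.le (by positivity)]; congr 1; field_simp
  have hVp : V ^ p = V ^ (p - 1) * V := by
    rw [← Real.rpow_add_one hVpos.ne']; congr 1; ring
  have hVV : 0 < V ^ (p - 1) := by positivity
  have h2p : (0 : ℝ) < 2 ^ p := by positivity
  rw [Real.div_rpow hVpos.le (by norm_num), div_le_iff₀ h2p, hST, hVp] at hl2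
  have hl3 : V ≤ a * T * 2 ^ p := by
    have : V ^ (p - 1) * V ≤ V ^ (p - 1) * (a * T * 2 ^ p) := by linarith
    exact le_of_mul_le_mul_left this hVV
  have h4 : A * T ≤ K * V := by
    have : V⁻¹ * A * T = (A * T) / V := by field_simp
    rw [this, div_le_iff₀ hVpos] at h
    exact h
  have : A * V ≤ (2 ^ p * K * a) * V := by
    calc A * V ≤ A * (a * T * 2 ^ p) := by gcongr
      _ = (A * T) * (a * 2 ^ p) := by ring
      _ ≤ (K * V) * (a * 2 ^ p) := by gcongr
      _ = _ := by ring
  exact le_of_mul_le_mul_right this hVpos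

lemma ball_half {n : ℕ} (hn : 2 ≤ n) (c c' : EE n) {ρ : ℝ} (hρ : 0 < ρ) :
    volume.real (ball c' (ρ / 2)) ≤ volume.real (ball c ρ) / 2 := by
  have h1 : volume (ball c' (ρ / 2)) = ENNReal.ofReal ((1 / 2) ^ n) * volume (ball c ρ) := by
    have := Measure.addHaar_ball_mul_of_pos (volume : Measure (EE n)) c' (r := 1 / 2)
      (by norm_num) ρ
    rw [Measure.addHaar_ball_center, Measure.addHaar_ball_center _ c ρ,
      show ρ / 2 = 1 / 2 * ρ by ring, ← Measure.addHaar_ball_center _ c', this]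
    simp
  rw [measureReal_def, h1, ENNReal.toReal_mul, ENNReal.toReal_ofReal (by positivity),
    ← measureReal_def]
  have : ((1 : ℝ) / 2) ^ n ≤ (1 / 2) ^ 1 :=
    pow_le_pow_of_le_one (by norm_num) (by norm_num) (by omega)
  nlinarith [measureReal_nonneg (μ := (volume : Measure (EE n))) (s := ball c ρ)]

lemma ap_decay {n : ℕ} (hn : 2 ≤ n) {p K : ℝ} (hp : 1 < p) {ω : EE n → ℝ} (hc : Continuous ω)
    (hpos : ∀ x, 0 < ω x) (hAp : IsApWeight n p K ω) :
    ∃ θ : ℝ, 0 ≤ θ ∧ θ < 1 ∧ ∀ (c c' : EE n) (ρ : ℝ), 0 < ρ → ball c' (ρ / 2) ⊆ ball c ρ →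
      (∫ z in ball c' (ρ / 2), ω z) ≤ θ * ∫ z in ball c ρ, ω z := by
  set M := max ((2 : ℝ) ^ p * K) 1 with hM
  have hM1 : 1 ≤ M := le_max_right _ _
  refine ⟨1 - M⁻¹, by linarith [inv_le_one_of_one_le₀ hM1], by
    have : 0 < M⁻¹ := by positivity
    linarith, ?_⟩
  intro c c' ρ hρ hsub
  have hF := ap_subset hp hc hpos hAp c hρ (ball c ρ \ ball c' (ρ / 2))
    (measurableSet_ball.diff measurableSet_ball) sdiff_subset (by
      rw [measureReal_sdiff hsub measurableSet_ball]
      linarith [ball_half hn c c' hρ])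
  have hd := setIntegral_sdiff (μ := volume) (measurableSet_ball (x := c') (ε := ρ / 2))
    (int_on hc c ρ) hsub
  set B := ∫ z in ball c ρ, ω z
  set F := ∫ z in ball c ρ \ ball c' (ρ / 2), ω z
  have hF0 : 0 ≤ F := integral_nonneg fun z => (hpos z).le
  have : B ≤ M * F := hF.trans (by gcongr; exact le_max_left _ _)
  have : M⁻¹ * B ≤ F := by
    rw [inv_mul_le_iff₀ (by positivity)]; exact this
  linarith

lemma cb_ae {n : ℕ} (c : EE n) {ρ : ℝ} (hρ : 0 < ρ) :
    (closedBall c ρ : Set (EE n)) =ᵐ[volume] ball c ρ := by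
  have h := Measure.addHaar_sphere_of_ne_zero (volume : Measure (EE n)) c hρ.ne'
  rw [← ball_union_sphere]
  exact union_ae_eq_left_of_ae_eq_empty (ae_eq_empty.2 h)

lemma cb_pos {n : ℕ} (c : EE n) {ρ : ℝ} (hρ : 0 < ρ) : 0 < volume.real (closedBall c ρ) :=
  ENNReal.toReal_pos (measure_closedBall_pos _ _ hρ).ne' measure_closedBall_lt_top.ne

lemma change_var {n : ℕ} {ω : EE n → ℝ} (x m : EE n) {R s : ℝ} (hR : 0 < R) (hs : 0 < s) :
    s ^ n * (∫ v in closedBall m R, ω (x + s • (v - x)))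
      = ∫ z in ball (x + s • (m - x)) (s * R), ω z := by
  have h1 : (∫ v in closedBall m R, ω (x + s • (v - x)))
      = ∫ w in closedBall (m - x) R, ω (x + s • w) := by
    have h := (measurePreserving_sub_right (volume : Measure (EE n)) x).setIntegral_preimage_emb
      (Homeomorph.subRight x).measurableEmbedding (fun w => ω (x + s • w)) (closedBall (m - x) R)
    rw [← h]
    congr 2
    ext v; simp
  have h2 : (∫ z in ball (x + s • (m - x)) (s * R), ω z)
      = ∫ w in ball (s • (m - x)) (s * R), ω (x + w) := by
    have h := (measurePreserving_add_left (volume : Measure (EE n)) x).setIntegral_preimage_emb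
      (Homeomorph.addLeft x).measurableEmbedding ω (ball (x + s • (m - x)) (s * R))
    rw [← h]
    congr 2
    ext v; simp
  rw [h1, h2, setIntegral_congr_set (cb_ae _ hR),
    Measure.setIntegral_comp_smul_of_pos volume (fun w => ω (x + w)) _ hs, _root_.smul_ball hs.ne']
  have : ‖s‖ * R = s * R := by rw [Real.norm_of_nonneg hs.le]
  rw [this]
  simp only [finrank_euclideanSpace, Fintype.card_fin, smul_eq_mul]
  field_simp

lemma jensen_pow {n : ℕ} (hn : 2 ≤ n) {f : EE n → ℝ} (hf : Continuous f) (hpos : ∀ x, 0 ≤ f x)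
    (m : EE n) {R : ℝ} (hR : 0 < R) :
    (⨍ v in closedBall m R, f v ^ ((1 : ℝ) / n)) ≤ (⨍ v in closedBall m R, f v) ^ ((1 : ℝ) / n) := by
  have hn' : (0 : ℝ) < n := by positivity
  have hc : Continuous (fun t : ℝ => t ^ ((1 : ℝ) / n)) :=
    continuous_id.rpow_const (fun _ => Or.inr (by positivity))
  have := ConcaveOn.le_map_set_average (μ := volume) (t := closedBall m R) (f := f)
    (Real.concaveOn_rpow (p := (1 : ℝ) / n) (by positivity)
      (by rw [div_le_one hn']; exact_mod_cast (by omega : 1 ≤ n)))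
    hc.continuousOn isClosed_Ici (measure_closedBall_pos _ _ hR).ne' measure_closedBall_lt_top.ne
    (Filter.Eventually.of_forall hpos)
    (hf.continuousOn.integrableOn_compact (isCompact_closedBall m R))
    ((hc.comp hf).continuousOn.integrableOn_compact (isCompact_closedBall m R))
  exact this

lemma self_bound {h : ℝ → ℝ} (hc : Continuous h) {τ H : ℝ} (hτ : τ < 1)
    (h1 : ∀ s, 0 < s → s ≤ 1 → h (s / 2) ≤ 2 * τ * h s)
    (h2 : ∀ s, 0 < s → s ≤ 1 → s * h s ≤ H) (hH : 0 ≤ H) :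
    (∫ s in (0 : ℝ)..1, h s) ≤ H / (1 - τ) := by
  have hsplit : (∫ s in (0 : ℝ)..1, h s) = (∫ s in (0 : ℝ)..(1/2), h s) + ∫ s in (1/2 : ℝ)..1, h s :=
    (intervalIntegral.integral_add_adjacent_intervals (hc.intervalIntegrable _ _)
      (hc.intervalIntegrable _ _)).symm
  have ha : (∫ s in (0 : ℝ)..(1/2), h s) = 2⁻¹ * ∫ s in (0 : ℝ)..1, h (s / 2) := by
    rw [intervalIntegral.integral_comp_div (fun s => h s) (by norm_num : (2:ℝ) ≠ 0)]
    simp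
  have hb : (∫ s in (0 : ℝ)..1, h (s / 2)) ≤ ∫ s in (0 : ℝ)..1, 2 * τ * h s := by
    apply intervalIntegral.integral_mono_on_of_le_Ioo (by norm_num)
    · exact (hc.comp (continuous_id.div_const 2)).intervalIntegrable _ _
    · exact (continuous_const.mul hc).intervalIntegrable _ _
    · intro s hs; exact h1 s hs.1 hs.2.le
  have hd : (∫ s in (1/2 : ℝ)..1, h s) ≤ ∫ s in (1/2 : ℝ)..1, 2 * H := by
    apply intervalIntegral.integral_mono_on_of_le_Ioo (by norm_num)
    · exact hc.intervalIntegrable _ _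
    · exact continuous_const.intervalIntegrable _ _
    · intro s hs
      have := h2 s (by linarith [hs.1]) hs.2.le
      by_cases h0 : 0 ≤ h s
      · nlinarith [hs.1]
      · linarith
  rw [intervalIntegral.integral_const_mul] at hb
  rw [intervalIntegral.integral_const] at hd
  norm_num at hd
  rw [le_div_iff₀ (by linarith)]
  linarith

lemma swap_avg {n : ℕ} {F : EE n → ℝ → ℝ} (hF : Continuous (fun q : EE n × ℝ => F q.1 q.2))
    (m : EE n) (R : ℝ) :
    (⨍ v in closedBall m R, ∫ s in (0 : ℝ)..1, F v s)
      = ∫ s in (0 : ℝ)..1, ⨍ v in closedBall m R, F v s := by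
  simp only [setAverage_eq, smul_eq_mul]
  rw [intervalIntegral.integral_const_mul]
  congr 1
  simp only [intervalIntegral.integral_of_le (zero_le_one' ℝ)]
  rw [integral_integral_swap]
  rw [Measure.prod_restrict]
  exact (hF.continuousOn.integrableOn_compact
    ((isCompact_closedBall m R).prod (isCompact_Icc (a := (0:ℝ)) (b := 1)))).mono_set
    (prod_mono le_rfl Ioc_subset_Icc_self)

lemma key_upper {n : ℕ} (hn : 2 ≤ n) {ω : EE n → ℝ} (hc : Continuous ω) (hpos : ∀ x, 0 < ω x)
    {θ : ℝ} (hθ0 : 0 ≤ θ) (hθ1 : θ < 1)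
    (hdec : ∀ (c c' : EE n) (ρ : ℝ), 0 < ρ → ball c' (ρ / 2) ⊆ ball c ρ →
      (∫ z in ball c' (ρ / 2), ω z) ≤ θ * ∫ z in ball c ρ, ω z)
    (m x : EE n) {R : ℝ} (hR : 0 < R) (hx : x ∈ closedBall m R) :
    (⨍ v in closedBall m R, ∫ s in (0 : ℝ)..1, ω (x + s • (v - x)) ^ ((1 : ℝ) / n))
      ≤ (⨍ v in closedBall m R, ω v) ^ ((1 : ℝ) / n) / (1 - θ ^ ((1 : ℝ) / n)) := by
  have hn0 : n ≠ 0 := by omega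
  have hn' : (0 : ℝ) < n := by positivity
  have hdist : dist x m ≤ R := hx
  have hVp := cb_pos m hR
  set V := volume.real (closedBall m R)
  have hcc : Continuous (fun q : EE n × ℝ => ω (x + q.2 • (q.1 - x))) := by fun_prop
  rw [swap_avg (F := fun v s => ω (x + s • (v - x)) ^ ((1 : ℝ) / n))
    (hcc.rpow_const (fun q => Or.inl (hpos _).ne'))]
  set g : ℝ → ℝ := fun s => ⨍ v in closedBall m R, ω (x + s • (v - x)) with hg
  have hgc : Continuous g := by
    simp only [hg, setAverage_eq, smul_eq_mul]
    refine continuous_const.mul ?_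
    exact continuous_parametric_integral_of_continuous (by fun_prop) (isCompact_closedBall m R)
  have hg0 : ∀ s, 0 ≤ g s := by
    intro s
    simp only [hg, setAverage_eq, smul_eq_mul]
    exact mul_nonneg (by positivity) (integral_nonneg fun v => (hpos _).le)
  have hgV : ∀ s, 0 < s → s ^ n * g s = V⁻¹ * ∫ z in ball (x + s • (m - x)) (s * R), ω z := by
    intro s hs
    rw [← change_var x m hR hs]
    simp only [hg, setAverage_eq, smul_eq_mul]; ring
  have hg1 : g 1 = ⨍ v in closedBall m R, ω v := by simp [hg]
  rw [← hg1]
  set h : ℝ → ℝ := fun s => g s ^ ((1 : ℝ) / n) with hh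
  have hhc : Continuous h := hgc.rpow_const (fun _ => Or.inr (by positivity))
  have root : ∀ a : ℝ, 0 ≤ a → (a ^ n) ^ ((1 : ℝ) / n) = a := by
    intro a ha; rw [one_div]; exact Real.pow_rpow_inv_natCast ha hn0
  have hmono : (∫ s in (0 : ℝ)..1, ⨍ v in closedBall m R, ω (x + s • (v - x)) ^ ((1 : ℝ) / n))
      ≤ ∫ s in (0 : ℝ)..1, h s := by
    apply intervalIntegral.integral_mono_on (by norm_num)
    · refine Continuous.intervalIntegrable ?_ _ _
      simp only [setAverage_eq, smul_eq_mul]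
      refine continuous_const.mul ?_
      refine continuous_parametric_integral_of_continuous (f := fun s v => ω (x + s • (v - x)) ^ ((1 : ℝ) / n)) ?_ (isCompact_closedBall m R)
      exact (hcc.comp continuous_swap).rpow_const (fun q => Or.inl (hpos _).ne')
    · exact hhc.intervalIntegrable _ _
    · intro s _
      exact jensen_pow hn (f := fun v => ω (x + s • (v - x))) (by fun_prop) (fun v => (hpos _).le) m hR
  refine hmono.trans ?_
  refine self_bound hhc (τ := θ ^ ((1 : ℝ) / n)) (Real.rpow_lt_one hθ0 hθ1 (by positivity)) ?_ ?_
    (Real.rpow_nonneg (hg0 1) _)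
  · intro s hs hs1
    have e1 := hgV s hs
    have e2 := hgV (s / 2) (by positivity)
    have hd := hdec (x + s • (m - x)) (x + (s / 2) • (m - x)) (s * R) (by positivity) (by
      apply ball_subset_ball'
      have : dist (x + (s / 2) • (m - x)) (x + s • (m - x)) = s / 2 * dist x m := by
        rw [dist_eq_norm, dist_eq_norm, show x + (s / 2) • (m - x) - (x + s • (m - x))
          = (s / 2) • (x - m) by module, norm_smul, Real.norm_of_nonneg (by positivity)]
      rw [this]
      nlinarith)
    rw [show s / 2 * R = s * R / 2 by ring] at e2
    have h3 : (s / 2) ^ n * g (s / 2) ≤ θ * (s ^ n * g s) := by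
      rw [e1, e2]
      calc _ ≤ V⁻¹ * (θ * ∫ z in ball (x + s • (m - x)) (s * R), ω z) := by gcongr
        _ = _ := by ring
    have h4 : g (s / 2) ≤ 2 ^ n * (θ * g s) := by
      rw [div_pow] at h3
      have hsn : 0 < s ^ n := by positivity
      have : s ^ n * g (s / 2) ≤ s ^ n * (2 ^ n * (θ * g s)) := by
        have e : s ^ n / 2 ^ n * g (s / 2) = (s ^ n * g (s / 2)) / 2 ^ n := by ring
        rw [e, div_le_iff₀ (by positivity)] at h3
        linarith
      exact le_of_mul_le_mul_left this hsn
    calc h (s / 2) ≤ (2 ^ n * (θ * g s)) ^ ((1 : ℝ) / n) :=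
          Real.rpow_le_rpow (hg0 _) h4 (by positivity)
      _ = 2 * θ ^ ((1 : ℝ) / n) * h s := by
        rw [Real.mul_rpow (by positivity) (mul_nonneg hθ0 (hg0 _)), Real.mul_rpow hθ0 (hg0 _),
          root 2 (by norm_num)]; ring
  · intro s hs hs1
    have e1 := hgV s hs
    have e2 := hgV 1 one_pos
    have h3 : s ^ n * g s ≤ g 1 := by
      rw [one_pow, one_mul] at e2
      rw [e1, e2]
      refine mul_le_mul_of_nonneg_left ?_ (by positivity)
      refine setIntegral_mono_set (int_on hc _ _)
        (Filter.Eventually.of_forall fun z => (hpos z).le) (LE.le.eventuallyLE ?_)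
      apply ball_subset_ball'
      have : dist (x + s • (m - x)) (x + (1 : ℝ) • (m - x)) = (1 - s) * dist x m := by
        rw [dist_eq_norm, dist_eq_norm, show x + s • (m - x) - (x + (1 : ℝ) • (m - x))
          = (1 - s) • (x - m) by module, norm_smul, Real.norm_of_nonneg (by linarith)]
      rw [this]
      nlinarith
    calc s * h s = (s ^ n * g s) ^ ((1 : ℝ) / n) := by
          rw [Real.mul_rpow (by positivity) (hg0 _), root s hs.le]
      _ ≤ _ := Real.rpow_le_rpow (mul_nonneg (by positivity) (hg0 _)) h3 (by positivity)

/-- The two-segment curve from `x` through `v` to `y`. -/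
noncomputable def brk {n : ℕ} (R : ℝ) (x v y : EE n) (t : ℝ) : EE n :=
  if t ≤ 2 * R then x + (t / (2 * R)) • (v - x) else y + ((4 * R - t) / (2 * R)) • (v - y)

lemma brk_right {n : ℕ} {R : ℝ} (hR : 0 < R) (x v y : EE n) {t : ℝ} (ht : 2 * R ≤ t) :
    brk R x v y t = y + ((4 * R - t) / (2 * R)) • (v - y) := by
  unfold brk
  split_ifs with h
  · have : t = 2 * R := le_antisymm h ht
    subst this
    rw [show (4 * R - 2 * R) / (2 * R) = 1 by field_simp; ring, div_self (by positivity)]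
    module
  · rfl

lemma brk_left {n : ℕ} {R : ℝ} (x v y : EE n) {t : ℝ} (ht : t ≤ 2 * R) :
    brk R x v y t = x + (t / (2 * R)) • (v - x) := by
  unfold brk; rw [if_pos ht]

lemma brk_lip {n : ℕ} {R : ℝ} (hR : 0 < R) {m x v y : EE n} (hx : x ∈ closedBall m R)
    (hy : y ∈ closedBall m R) (hv : v ∈ closedBall m R) : LipschitzWith 1 (brk R x v y) := by
  have hvx : ‖v - x‖ ≤ 2 * R := by
    rw [← dist_eq_norm]
    linarith [dist_triangle_right v x m, mem_closedBall.1 hx, mem_closedBall.1 hv]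
  have hvy : ‖v - y‖ ≤ 2 * R := by
    rw [← dist_eq_norm]
    linarith [dist_triangle_right v y m, mem_closedBall.1 hy, mem_closedBall.1 hv]
  have hl : ∀ s t, s ≤ t → t ≤ 2 * R → dist (brk R x v y s) (brk R x v y t) ≤ t - s := by
    intro s t hst ht
    rw [brk_left _ _ _ ht, brk_left _ _ _ (hst.trans ht), dist_eq_norm,
      show x + (s / (2 * R)) • (v - x) - (x + (t / (2 * R)) • (v - x))
        = ((s - t) / (2 * R)) • (v - x) by module, norm_smul, Real.norm_eq_abs, abs_div,
      abs_of_nonpos (by linarith : s - t ≤ 0), abs_of_pos (by positivity : 0 < 2 * R)]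
    rw [div_mul_eq_mul_div, div_le_iff₀ (by positivity)]
    nlinarith
  have hr : ∀ s t, s ≤ t → 2 * R ≤ s → dist (brk R x v y s) (brk R x v y t) ≤ t - s := by
    intro s t hst hs
    rw [brk_right hR _ _ _ hs, brk_right hR _ _ _ (hs.trans hst), dist_eq_norm,
      show y + ((4 * R - s) / (2 * R)) • (v - y) - (y + ((4 * R - t) / (2 * R)) • (v - y))
        = ((t - s) / (2 * R)) • (v - y) by module, norm_smul, Real.norm_eq_abs, abs_div,
      abs_of_nonneg (by linarith : 0 ≤ t - s), abs_of_pos (by positivity : 0 < 2 * R)]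
    rw [div_mul_eq_mul_div, div_le_iff₀ (by positivity)]
    nlinarith
  have hall : ∀ s t, s ≤ t → dist (brk R x v y s) (brk R x v y t) ≤ t - s := by
    intro s t hst
    rcases le_total t (2 * R) with h | h
    · exact hl s t hst h
    rcases le_total (2 * R) s with h' | h'
    · exact hr s t hst h'
    · linarith [dist_triangle (brk R x v y s) (brk R x v y (2 * R)) (brk R x v y t),
        hl s _ h' le_rfl, hr _ t h le_rfl]
  refine LipschitzWith.of_dist_le_mul fun s t => ?_
  rw [NNReal.coe_one, one_mul, Real.dist_eq]
  rcases le_total s t with h | h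
  · rw [abs_of_nonpos (by linarith)]; linarith [hall s t h]
  · rw [abs_of_nonneg (by linarith), dist_comm]; exact hall t s h

lemma brk_mem {n : ℕ} {R : ℝ} (hR : 0 < R) {m x v y : EE n} (hx : x ∈ closedBall m R)
    (hy : y ∈ closedBall m R) (hv : v ∈ closedBall m R) {t : ℝ} (ht : t ∈ Icc 0 (4 * R)) :
    brk R x v y t ∈ closedBall m R := by
  have hconv := convex_closedBall m R
  rcases le_total t (2 * R) with h | h
  · rw [brk_left _ _ _ h]
    exact hconv.add_smul_sub_mem hx hv
      ⟨div_nonneg ht.1 (by positivity), by rw [div_le_one (by positivity)]; exact h⟩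
  · rw [brk_right hR _ _ _ h]
    exact hconv.add_smul_sub_mem hy hv
      ⟨div_nonneg (by linarith [ht.2]) (by positivity), by
        rw [div_le_one (by positivity)]; linarith⟩

lemma brk_int {n : ℕ} {R : ℝ} (hR : 0 < R) {m x v y : EE n} (hx : x ∈ closedBall m R)
    (hy : y ∈ closedBall m R) (hv : v ∈ closedBall m R) {f : EE n → ℝ} (hf : Continuous f) :
    (∫ t in (0 : ℝ)..(4 * R), f (brk R x v y t)) =
      2 * R * ((∫ s in (0 : ℝ)..1, f (x + s • (v - x))) + ∫ s in (0 : ℝ)..1, f (y + s • (v - y))) := by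
  have hc : Continuous fun t => f (brk R x v y t) := hf.comp (brk_lip hR hx hy hv).continuous
  rw [← intervalIntegral.integral_add_adjacent_intervals (b := 2 * R)
    (hc.intervalIntegrable _ _) (hc.intervalIntegrable _ _), mul_add]
  have h2R : 2 * R ≠ 0 := by positivity
  congr 1
  · have : (∫ t in (0 : ℝ)..(2 * R), f (brk R x v y t))
        = ∫ t in (0 : ℝ)..(2 * R), f (x + (t / (2 * R)) • (v - x)) := by
      apply intervalIntegral.integral_congr
      intro t ht
      rw [uIcc_of_le (by positivity)] at ht
      simp only [brk_left _ _ _ ht.2]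
    rw [this, intervalIntegral.integral_comp_div (fun s => f (x + s • (v - x))) h2R]
    simp [h2R]
  · have : (∫ t in (2 * R)..(4 * R), f (brk R x v y t))
        = ∫ t in (2 * R)..(4 * R), f (y + (2 - t / (2 * R)) • (v - y)) := by
      apply intervalIntegral.integral_congr
      intro t ht
      rw [uIcc_of_le (by linarith)] at ht
      simp only [brk_right hR _ _ _ ht.1]
      rw [show (4 * R - t) / (2 * R) = 2 - t / (2 * R) by field_simp; ring]
    rw [this, intervalIntegral.integral_comp_sub_div (fun s => f (y + s • (v - y))) h2R]
    rw [show (2 : ℝ) - 4 * R / (2 * R) = 0 by field_simp; ring,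
      show (2 : ℝ) - 2 * R / (2 * R) = 1 by field_simp; ring, smul_eq_mul]

/-- The set over which `dW` takes the infimum. -/
def dSet (n : ℕ) (ω : EE n → ℝ) (x y : EE n) : Set ℝ :=
  {d : ℝ | ∃ (L : ℝ) (γ : ℝ → EuclideanSpace ℝ (Fin n)),
    0 ≤ L ∧ LipschitzOnWith 1 γ (Set.Icc 0 L) ∧ γ 0 = x ∧ γ L = y ∧
    (∀ t ∈ Set.Icc 0 L, γ t ∈ closedBall (midpoint ℝ x y) (dist x y / 2)) ∧
    d = ∫ t in (0 : ℝ)..L, (ω (γ t)) ^ ((1 : ℝ) / n)}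

lemma dSet_nonneg {n : ℕ} {ω : EE n → ℝ} (hpos : ∀ x, 0 < ω x) {x y : EE n} :
    ∀ d ∈ dSet n ω x y, 0 ≤ d := by
  rintro d ⟨L, γ, hL, -, -, -, -, rfl⟩
  exact intervalIntegral.integral_nonneg hL fun t _ => Real.rpow_nonneg (hpos _).le _

lemma dW_le {n : ℕ} {ω : EE n → ℝ} (hpos : ∀ x, 0 < ω x) {x y : EE n} {d : ℝ}
    (hd : d ∈ dSet n ω x y) : dW n ω x y ≤ d :=
  csInf_le ⟨0, fun d hd => dSet_nonneg hpos d hd⟩ hd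

lemma ends_mem {n : ℕ} (x y : EE n) :
    x ∈ closedBall (midpoint ℝ x y) (dist x y / 2) ∧
      y ∈ closedBall (midpoint ℝ x y) (dist x y / 2) := by
  constructor
  · rw [mem_closedBall, dist_left_midpoint]; simp; linarith
  · rw [mem_closedBall, dist_right_midpoint]; simp; linarith

lemma brk_dSet {n : ℕ} {ω : EE n → ℝ} (hc : Continuous ω) (hpos : ∀ x, 0 < ω x) {x y v : EE n}
    (hxy : 0 < dist x y / 2) (hv : v ∈ closedBall (midpoint ℝ x y) (dist x y / 2)) :
    2 * (dist x y / 2) * ((∫ s in (0 : ℝ)..1, ω (x + s • (v - x)) ^ ((1 : ℝ) / n))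
      + ∫ s in (0 : ℝ)..1, ω (y + s • (v - y)) ^ ((1 : ℝ) / n)) ∈ dSet n ω x y := by
  obtain ⟨hx, hy⟩ := ends_mem x y
  refine ⟨4 * (dist x y / 2), brk (dist x y / 2) x v y, by positivity,
    (brk_lip hxy hx hy hv).lipschitzOnWith, ?_, ?_, fun t ht => brk_mem hxy hx hy hv ht, ?_⟩
  · rw [brk_left _ _ _ (by positivity)]; simp
  · rw [brk_right hxy _ _ _ (by linarith)]; simp
  · exact (brk_int hxy hx hy hv (rpow_cont hc hpos _)).symm

lemma zero_dSet {n : ℕ} (ω : EE n → ℝ) (x : EE n) : 0 ∈ dSet n ω x x :=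
  ⟨0, fun _ => x, le_rfl, (LipschitzWith.const' x).lipschitzOnWith, rfl, rfl,
    fun _ _ => (ends_mem x x).1, by simp⟩

lemma dSet_nonempty {n : ℕ} {ω : EE n → ℝ} (hc : Continuous ω) (hpos : ∀ x, 0 < ω x) (x y : EE n) :
    (dSet n ω x y).Nonempty := by
  by_cases h : x = y
  · subst h; exact ⟨0, zero_dSet ω x⟩
  · exact ⟨_, brk_dSet hc hpos (by have := dist_pos.2 h; positivity) (ends_mem x y).1⟩

lemma deltaW_nonneg {n : ℕ} {ω : EE n → ℝ} (hpos : ∀ x, 0 < ω x) (x y : EE n) :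
    0 ≤ deltaW n ω x y :=
  Real.rpow_nonneg (integral_nonneg fun z => (hpos z).le) _

lemma upper {n : ℕ} (hn : 2 ≤ n) {p K : ℝ} (hp : 1 < p) {ω : EE n → ℝ} (hc : Continuous ω)
    (hpos : ∀ x, 0 < ω x) (hAp : IsApWeight n p K ω) :
    ∃ C : ℝ, 0 < C ∧ ∀ x y, dW n ω x y ≤ C * deltaW n ω x y := by
  have hn0 : n ≠ 0 := by omega
  have hn' : (0 : ℝ) < n := by positivity
  obtain ⟨θ, hθ0, hθ1, hdec⟩ := ap_decay hn hp hc hpos hAp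
  have hτ : θ ^ ((1 : ℝ) / n) < 1 := Real.rpow_lt_one hθ0 hθ1 (by positivity)
  set τ := θ ^ ((1 : ℝ) / n)
  set U := volume.real (ball (0 : EE n) 1)
  have hU : 0 < U := ENNReal.toReal_pos (measure_ball_pos _ _ one_pos).ne' measure_ball_lt_top.ne
  have h1τ : 0 < 1 - τ := by linarith
  refine ⟨4 * (U⁻¹) ^ ((1 : ℝ) / n) / (1 - τ), by positivity, ?_⟩
  intro x y
  by_cases hxy : x = y
  · subst hxy
    refine (dW_le hpos (zero_dSet ω x)).trans (mul_nonneg (by positivity) (deltaW_nonneg hpos _ _))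
  have hR : 0 < dist x y / 2 := by have := dist_pos.2 hxy; positivity
  obtain ⟨hx, hy⟩ := ends_mem x y
  have hmem := fun v => brk_dSet (v := v) hc hpos hR
  have hdelta : deltaW n ω x y =
    (∫ z in closedBall (midpoint ℝ x y) (dist x y / 2), ω z) ^ ((1 : ℝ) / n) := rfl
  set R := dist x y / 2
  set m := midpoint ℝ x y
  have kx := key_upper hn hc hpos hθ0 hθ1 hdec m x hR hx
  have ky := key_upper hn hc hpos hθ0 hθ1 hdec m y hR hy
  have jc : ∀ w : EE n, Continuous fun v : EE n =>
      ∫ s in (0 : ℝ)..1, ω (w + s • (v - w)) ^ ((1 : ℝ) / n) := by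
    intro w
    refine intervalIntegral.continuous_parametric_intervalIntegral_of_continuous'
      (f := fun (v : EE n) s => ω (w + s • (v - w)) ^ ((1 : ℝ) / n)) ?_ 0 1
    have : Continuous (fun q : EE n × ℝ => ω (w + q.2 • (q.1 - w))) := by fun_prop
    exact this.rpow_const (fun q => Or.inl (hpos _).ne')
  have ji := fun w => (jc w).continuousOn.integrableOn_compact (μ := volume) (isCompact_closedBall m R)
  obtain ⟨v, hv, hvle⟩ := exists_le_setAverage (μ := volume) (s := closedBall m R)
    (measure_closedBall_pos _ _ hR).ne' measure_closedBall_lt_top.ne ((ji x).add (ji y))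
  have hsum := integral_add (ji x) (ji y)
  simp only [setAverage_eq, smul_eq_mul, Pi.add_apply] at hvle kx ky
  rw [hsum, mul_add] at hvle
  refine (dW_le hpos (hmem v hv)).trans ?_
  have hV : volume.real (closedBall m R) = R ^ n * U := by
    rw [measureReal_def, Measure.addHaar_closedBall _ _ hR.le, ENNReal.toReal_mul,
      ENNReal.toReal_ofReal (by positivity)]
    simp [U, measureReal_def]
  have hI0 : 0 ≤ ∫ z in closedBall m R, ω z := integral_nonneg fun z => (hpos z).le
  have hroot : R * ((volume.real (closedBall m R))⁻¹ * ∫ z in closedBall m R, ω z) ^ ((1 : ℝ) / n)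
      = (U⁻¹) ^ ((1 : ℝ) / n) * deltaW n ω x y := by
    rw [hdelta, hV, mul_inv, mul_assoc, Real.mul_rpow (by positivity) (by positivity),
      Real.mul_rpow (by positivity) (by positivity), ← inv_pow, one_div,
      Real.pow_rpow_inv_natCast (by positivity) hn0]
    field_simp
  set D := ((volume.real (closedBall m R))⁻¹ * ∫ z in closedBall m R, ω z) ^ ((1 : ℝ) / n)
  calc _ ≤ 2 * R * (D / (1 - τ) + D / (1 - τ)) := by
        exact mul_le_mul_of_nonneg_left (hvle.trans (add_le_add kx ky)) (by positivity)
    _ = 4 * (R * D) / (1 - τ) := by ring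
    _ = _ := by rw [hroot]; ring

lemma ap_exp {n : ℕ} {p K : ℝ} (hp : 1 < p) {ω : EE n → ℝ} (hc : Continuous ω)
    (hpos : ∀ x, 0 < ω x) (hAp : IsApWeight n p K ω) (c : EE n) {ρ : ℝ} (hρ : 0 < ρ) :
    (⨍ z in ball c ρ, ω z) ≤ K * Real.exp (⨍ z in ball c ρ, Real.log (ω z)) := by
  have hp0 : 0 < p - 1 := by linarith
  have hlc : Continuous fun z => Real.log (ω z) := hc.log fun z => (hpos z).ne'
  have h := hAp c ρ hρ
  have hj := ConvexOn.map_set_average_le (μ := volume) (t := ball c ρ)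
    (f := fun z => -(1 / (p - 1)) * Real.log (ω z)) convexOn_exp Real.continuous_exp.continuousOn
    isClosed_univ (measure_ball_pos _ _ hρ).ne' measure_ball_lt_top.ne
    (Filter.Eventually.of_forall fun _ => mem_univ _)
    (int_on (by fun_prop) c ρ) (int_on (by fun_prop) c ρ)
  have e : ∀ z, Real.exp (-(1 / (p - 1)) * Real.log (ω z)) = ω z ^ (-(1 / (p - 1))) := by
    intro z; rw [Real.rpow_def_of_pos (hpos z), mul_comm]
  simp only [Function.comp_def, e] at hj
  simp only [setAverage_eq, smul_eq_mul, measureReal_def, integral_const_mul] at hj ⊢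
  set V := (volume (ball c ρ)).toReal
  set A := ∫ z in ball c ρ, ω z
  set l := ∫ z in ball c ρ, Real.log (ω z)
  have hA : 0 ≤ V⁻¹ * A := mul_nonneg (by positivity) (integral_nonneg fun z => (hpos z).le)
  have h2 : Real.exp (-(V⁻¹ * l)) ≤ (V⁻¹ * ∫ z in ball c ρ, ω z ^ (-(1 / (p - 1)))) ^ (p - 1) := by
    refine le_trans (le_of_eq ?_) (Real.rpow_le_rpow (Real.exp_pos _).le hj hp0.le)
    rw [← Real.exp_mul]; congr 1; field_simp
  have h3 : V⁻¹ * A * Real.exp (-(V⁻¹ * l)) ≤ K :=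
    (mul_le_mul_of_nonneg_left h2 hA).trans h
  rw [Real.exp_neg, ← div_eq_mul_inv, div_le_iff₀ (Real.exp_pos _)] at h3
  exact h3

lemma exp_avg_log {n : ℕ} {ω : EE n → ℝ} (hc : Continuous ω)
    (hpos : ∀ x, 0 < ω x) (c : EE n) {ρ : ℝ} (hρ : 0 < ρ) :
    Real.exp (⨍ z in ball c ρ, Real.log (ω z)) ≤ ⨍ z in ball c ρ, ω z := by
  have hlc : Continuous fun z => Real.log (ω z) := hc.log fun z => (hpos z).ne'
  have hj := ConvexOn.map_set_average_le (μ := volume) (t := ball c ρ)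
    (f := fun z => Real.log (ω z)) convexOn_exp Real.continuous_exp.continuousOn
    isClosed_univ (measure_ball_pos _ _ hρ).ne' measure_ball_lt_top.ne
    (Filter.Eventually.of_forall fun _ => mem_univ _)
    (int_on (by fun_prop) c ρ) (int_on (by fun_prop) c ρ)
  simpa only [Function.comp_def, Real.exp_log (hpos _)] using hj

lemma ae_to_closedBall {n : ℕ} {f : EE n → ℝ} (hf : Continuous f) {a : ℝ} {c : EE n} {ρ : ℝ}
    (hρ : 0 < ρ) (h : ∀ᵐ z ∂(volume.restrict (ball c ρ)), a ≤ f z) :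
    ∀ z ∈ closedBall c ρ, a ≤ f z := by
  have hcl : IsClosed {z | a ≤ f z} := isClosed_le continuous_const hf
  have hsub : ball c ρ ⊆ {z | a ≤ f z} := by
    by_contra hns
    obtain ⟨z, hz, hzn⟩ := not_subset.1 hns
    have ho : IsOpen (ball c ρ ∩ {z | a ≤ f z}ᶜ) := isOpen_ball.inter hcl.isOpen_compl
    have hp := ho.measure_pos volume ⟨z, hz, hzn⟩
    rw [ae_restrict_iff' measurableSet_ball] at h
    have : volume (ball c ρ ∩ {z | a ≤ f z}ᶜ) = 0 := by
      refine measure_mono_null ?_ (ae_iff.1 h)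
      intro w hw hcon
      exact hw.2 (hcon hw.1)
    exact hp.ne' this
  have := closure_minimal hsub hcl
  rw [closure_ball c hρ.ne'] at this
  exact fun z hz => this hz

lemma setInt_pos {n : ℕ} {ω : EE n → ℝ} (hc : Continuous ω)
    (hpos : ∀ x, 0 < ω x) (c : EE n) {ρ : ℝ} (hρ : 0 < ρ) : 0 < ⨍ z in ball c ρ, ω z :=
  (Real.exp_pos _).trans_le (exp_avg_log hc hpos c hρ)

/-- Semmes, Lemma 3.17. If `ω₁` is an `A₁` weight, `ω₂` is a
strong `A_∞` weight, `r > 0`, and `ω = ω₁^r ω₂` is `A_p` for some `p > 1`, then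
`ω` is a strong `A_∞` weight. -/
theorem strongAinfty_of_mul
    (n : ℕ) (hn : 2 ≤ n)
    (ω₁ ω₂ : EuclideanSpace ℝ (Fin n) → ℝ)
    (h₁pos : ∀ x, 0 < ω₁ x) (h₁cont : Continuous ω₁)
    (h₂pos : ∀ x, 0 < ω₂ x) (h₂cont : Continuous ω₂)
    (K₁ : ℝ)
    (hA1 : ∀ (x : EuclideanSpace ℝ (Fin n)) (rad : ℝ), 0 < rad →
      ∀ᵐ z ∂(volume.restrict (ball x rad)),
        (volume (ball x rad)).toReal⁻¹ * (∫ y in ball x rad, ω₁ y) ≤ K₁ * ω₁ z)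
    (hstrong₂ : ∃ q K₂ C₂ : ℝ, 1 < q ∧ IsApWeight n q K₂ ω₂ ∧ 0 < C₂ ∧
      ∀ x y : EuclideanSpace ℝ (Fin n),
        C₂⁻¹ * deltaW n ω₂ x y ≤ dW n ω₂ x y ∧ dW n ω₂ x y ≤ C₂ * deltaW n ω₂ x y)
    (r : ℝ) (hr : 0 < r)
    (hAp : ∃ p K : ℝ, 1 < p ∧ IsApWeight n p K (fun x => ω₁ x ^ r * ω₂ x)) :
    ∃ C : ℝ, 0 < C ∧
      ∀ x y : EuclideanSpace ℝ (Fin n),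
        C⁻¹ * deltaW n (fun z => ω₁ z ^ r * ω₂ z) x y ≤
            dW n (fun z => ω₁ z ^ r * ω₂ z) x y ∧
        dW n (fun z => ω₁ z ^ r * ω₂ z) x y ≤
            C * deltaW n (fun z => ω₁ z ^ r * ω₂ z) x y := by
  obtain ⟨q, K₂, C₂, -, -, hC₂, h₂⟩ := hstrong₂
  obtain ⟨p, K, hp, hAp⟩ := hAp
  have hn0 : n ≠ 0 := by omega
  have hn' : (0 : ℝ) < n := by positivity
  set ω : EE n → ℝ := fun x => ω₁ x ^ r * ω₂ x with hω
  have h₁r : Continuous fun x => ω₁ x ^ r := rpow_cont h₁cont h₁pos r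
  have hc : Continuous ω := h₁r.mul h₂cont
  have hpos : ∀ x, 0 < ω x := fun x => mul_pos (Real.rpow_pos_of_pos (h₁pos x) _) (h₂pos x)
  obtain ⟨C, hC, hup⟩ := upper hn hp hc hpos hAp
  have hK₁ : 0 < K₁ := by
    have h := ae_to_closedBall (continuous_const.mul h₁cont) one_pos (hA1 0 1 one_pos) 0 (by simp)
    have h' := setInt_pos h₁cont h₁pos 0 one_pos
    rw [setAverage_eq, smul_eq_mul] at h'
    exact pos_of_mul_pos_left (h'.trans_le h) (h₁pos 0).le
  have hK : 0 < K := by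
    have h := ap_exp hp hc hpos hAp 0 one_pos
    exact pos_of_mul_pos_left ((setInt_pos hc hpos 0 one_pos).trans_le h) (Real.exp_pos _).le
  set N := (1 : ℝ) / n with hN
  have hN0 : 0 < N := by positivity
  set M := C₂ * (K₁ ^ r * K) ^ N with hM
  have hM0 : 0 < M := by positivity
  have low : ∀ x y, deltaW n ω x y ≤ M * dW n ω x y := by
    intro x y
    by_cases hxy : x = y
    · subst hxy
      have h0 : deltaW n ω x x = 0 := by
        have : (volume.restrict ({x} : Set (EE n))) = 0 := by
          have : Nonempty (Fin n) := ⟨⟨0, by omega⟩⟩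
          rw [Measure.restrict_eq_zero]; exact measure_singleton x
        simp [deltaW, this, hn0]
      rw [h0]
      exact mul_nonneg hM0.le (le_csInf (dSet_nonempty hc hpos x x) (dSet_nonneg hpos))
    have hR : 0 < dist x y / 2 := by have := dist_pos.2 hxy; positivity
    have hd1 : deltaW n ω x y =
      (∫ z in closedBall (midpoint ℝ x y) (dist x y / 2), ω z) ^ N := rfl
    have hd2 : deltaW n ω₂ x y =
      (∫ z in closedBall (midpoint ℝ x y) (dist x y / 2), ω₂ z) ^ N := rfl
    have hA := ae_to_closedBall (continuous_const.mul h₁cont) hR (hA1 (midpoint ℝ x y) _ hR)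
    have ha := setInt_pos h₁cont h₁pos (midpoint ℝ x y) hR
    have hae := cb_ae (midpoint ℝ x y) hR
    have hl := exp_avg_log h₁cont h₁pos (midpoint ℝ x y) hR
    have hl2 := exp_avg_log h₂cont h₂pos (midpoint ℝ x y) hR
    have hw := ap_exp hp hc hpos hAp (midpoint ℝ x y) hR
    rw [setIntegral_congr_set hae] at hd1 hd2
    have hV : 0 < volume.real (ball (midpoint ℝ x y) (dist x y / 2)) :=
      ENNReal.toReal_pos (measure_ball_pos _ _ hR).ne' measure_ball_lt_top.ne
    rw [← measureReal_def, ← smul_eq_mul, ← setAverage_eq] at hA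
    set a := ⨍ z in ball (midpoint ℝ x y) (dist x y / 2), ω₁ z with hadef
    have hlog : (⨍ z in ball (midpoint ℝ x y) (dist x y / 2), Real.log (ω z))
        = r * (⨍ z in ball (midpoint ℝ x y) (dist x y / 2), Real.log (ω₁ z))
          + ⨍ z in ball (midpoint ℝ x y) (dist x y / 2), Real.log (ω₂ z) := by
      have e : ∀ z, Real.log (ω z) = r * Real.log (ω₁ z) + Real.log (ω₂ z) := by
        intro z
        rw [hω]
        simp only
        rw [Real.log_mul (Real.rpow_pos_of_pos (h₁pos z) _).ne' (h₂pos z).ne',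
          Real.log_rpow (h₁pos z)]
      simp only [e, setAverage_eq, smul_eq_mul]
      rw [integral_add (f := fun z => r * Real.log (ω₁ z)) (int_on (continuous_const.mul (h₁cont.log fun z => (h₁pos z).ne')) _ _)
        (int_on (h₂cont.log fun z => (h₂pos z).ne') _ _), integral_const_mul]
      ring
    have hI2 : 0 ≤ ∫ z in ball (midpoint ℝ x y) (dist x y / 2), ω₂ z :=
      integral_nonneg fun z => (h₂pos z).le
    have hI : 0 ≤ ∫ z in ball (midpoint ℝ x y) (dist x y / 2), ω z :=
      integral_nonneg fun z => (hpos z).le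
    have hmain : (∫ z in ball (midpoint ℝ x y) (dist x y / 2), ω z)
        ≤ (K * a ^ r) * ∫ z in ball (midpoint ℝ x y) (dist x y / 2), ω₂ z := by
      rw [hlog, Real.exp_add, mul_comm r, Real.exp_mul] at hw
      have hw2 : (⨍ z in ball (midpoint ℝ x y) (dist x y / 2), ω z)
          ≤ K * (a ^ r * ⨍ z in ball (midpoint ℝ x y) (dist x y / 2), ω₂ z) :=
        hw.trans (by gcongr)
      rw [setAverage_eq, setAverage_eq, smul_eq_mul, smul_eq_mul, inv_mul_le_iff₀ hV] at hw2
      refine hw2.trans (le_of_eq ?_)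
      field_simp
    have hδ : deltaW n ω x y ≤ (K * a ^ r) ^ N * deltaW n ω₂ x y := by
      rw [hd1, hd2, ← Real.mul_rpow (by positivity) hI2]
      exact Real.rpow_le_rpow hI hmain hN0.le
    have hdd : (a / K₁) ^ (r * N) * dW n ω₂ x y ≤ dW n ω x y := by
      refine le_csInf (dSet_nonempty hc hpos x y) ?_
      rintro d ⟨L, γ, hL, hγ, h0, h1, hin, rfl⟩
      have hmem : (∫ t in (0 : ℝ)..L, (ω₂ (γ t)) ^ N) ∈ dSet n ω₂ x y :=
        ⟨L, γ, hL, hγ, h0, h1, hin, rfl⟩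
      refine (mul_le_mul_of_nonneg_left (dW_le h₂pos hmem) (by positivity)).trans ?_
      rw [← intervalIntegral.integral_const_mul]
      apply intervalIntegral.integral_mono_on hL
      · apply ContinuousOn.intervalIntegrable
        rw [uIcc_of_le hL]
        exact continuousOn_const.mul ((rpow_cont h₂cont h₂pos N).comp_continuousOn hγ.continuousOn)
      · apply ContinuousOn.intervalIntegrable
        rw [uIcc_of_le hL]
        exact (rpow_cont hc hpos N).comp_continuousOn hγ.continuousOn
      · intro t ht
        have hz : a ≤ K₁ * ω₁ (γ t) := hA _ (hin t ht)
        have hz' : a / K₁ ≤ ω₁ (γ t) := by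
          rw [div_le_iff₀ hK₁]; linarith
        rw [hω]
        simp only
        rw [Real.mul_rpow (Real.rpow_nonneg (h₁pos _).le _) (h₂pos _).le,
          ← Real.rpow_mul (h₁pos _).le]
        have := (h₂pos (γ t)).le
        gcongr
    have h2 := (h₂ x y).1
    rw [inv_mul_le_iff₀ hC₂] at h2
    calc deltaW n ω x y ≤ (K * a ^ r) ^ N * deltaW n ω₂ x y := hδ
      _ ≤ (K * a ^ r) ^ N * (C₂ * dW n ω₂ x y) := by gcongr
      _ = M * ((a / K₁) ^ (r * N) * dW n ω₂ x y) := by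
        rw [hM, Real.mul_rpow (by positivity) (by positivity),
          Real.mul_rpow (by positivity) (by positivity), ← Real.rpow_mul ha.le,
          ← Real.rpow_mul hK₁.le, Real.div_rpow ha.le hK₁.le]
        field_simp
      _ ≤ M * dW n ω x y := by gcongr
  refine ⟨max M C, by positivity, fun x y => ⟨?_, ?_⟩⟩
  · rw [inv_mul_le_iff₀ (by positivity)]
    have : 0 ≤ dW n ω x y := le_csInf (dSet_nonempty hc hpos x y) (dSet_nonneg hpos)
    exact (low x y).trans (by gcongr; exact le_max_left _ _)
  · have := deltaW_nonneg hpos x y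
    exact (hup x y).trans (by gcongr; exact le_max_right _ _)
end

section
/- Let n ≥ 2, let p > 1, and let ω be a positive continuous function on ℝⁿ that is an A_p weight with constant K. Then there exists a constant C depending only on n, p and K such that d_ω(x,y) ≤ C δ_ω(x,y) for all x, y ∈ ℝⁿ. -/
open MeasureTheory Metric Set
open scoped ENNReal

lemma contI {n : ℕ} {f : EuclideanSpace ℝ (Fin n) → ℝ} (hf : Continuous f)
    {s : Set (EuclideanSpace ℝ (Fin n))} {x : EuclideanSpace ℝ (Fin n)} {r : ℝ}
    (hs : s ⊆ closedBall x r) : IntegrableOn f s :=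
  (hf.continuousOn.integrableOn_compact (isCompact_closedBall x r)).mono_set hs

lemma contMemLp {n : ℕ} {f : EuclideanSpace ℝ (Fin n) → ℝ} (hf : Continuous f)
    {s : Set (EuclideanSpace ℝ (Fin n))} {x : EuclideanSpace ℝ (Fin n)} {r : ℝ}
    (hs : s ⊆ closedBall x r) (hm : MeasurableSet s) (q : ℝ≥0∞) :
    MemLp f q (volume.restrict s) := by
  obtain ⟨M, hM⟩ := (isCompact_closedBall x r).exists_bound_of_continuousOn hf.continuousOn
  have : IsFiniteMeasure (volume.restrict s) :=
    ⟨by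
      rw [Measure.restrict_apply_univ]
      exact (measure_mono hs).trans_lt measure_closedBall_lt_top⟩
  refine MemLp.of_bound hf.aestronglyMeasurable M ?_
  filter_upwards [ae_restrict_mem hm] with z hz using hM z (hs hz)

lemma Ap_subset {n : ℕ} {p K : ℝ} (hp : 1 < p) {ω : EuclideanSpace ℝ (Fin n) → ℝ}
    (hpos : ∀ x, 0 < ω x) (hc : Continuous ω) (hA : IsApWeight n p K ω)
    (x : EuclideanSpace ℝ (Fin n)) {r : ℝ} (hr : 0 < r) {E : Set (EuclideanSpace ℝ (Fin n))}
    (hE : MeasurableSet E) (hEB : E ⊆ ball x r) :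
    (volume.real E) ^ p * ∫ z in ball x r, ω z ≤
      K * (volume.real (ball x r)) ^ p * ∫ z in E, ω z := by
  have hp0 : 0 < p := by linarith
  have hp1 : 0 < p - 1 := by linarith
  set q : ℝ := p / (p - 1) with hq
  have hpq : p.HolderConjugate q := by
    rw [Real.holderConjugate_iff]
    refine ⟨hp, ?_⟩
    rw [hq]; field_simp; ring
  have hEc : E ⊆ closedBall x r := hEB.trans ball_subset_closedBall
  have hf : Continuous fun z => ω z ^ (1 / p) := hc.rpow_const fun z => Or.inl (hpos z).ne'
  have hg : Continuous fun z => ω z ^ (-(1 / p)) := hc.rpow_const fun z => Or.inl (hpos z).ne'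
  have hs : Continuous fun z => ω z ^ (-(1 / (p - 1))) :=
    hc.rpow_const fun z => Or.inl (hpos z).ne'
  have H := integral_mul_le_Lp_mul_Lq_of_nonneg (μ := volume.restrict E) hpq
    (f := fun z => ω z ^ (1 / p)) (g := fun z => ω z ^ (-(1 / p)))
    (Filter.Eventually.of_forall fun z => Real.rpow_nonneg (hpos z).le _)
    (Filter.Eventually.of_forall fun z => Real.rpow_nonneg (hpos z).le _)
    (contMemLp hf hEc hE _) (contMemLp hg hEc hE _)
  have e1 : ∀ z, ω z ^ (1 / p) * ω z ^ (-(1 / p)) = 1 := fun z => by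
    rw [← Real.rpow_add (hpos z)]; simp
  have e2 : ∀ z, (ω z ^ (1 / p)) ^ p = ω z := fun z => by
    rw [← Real.rpow_mul (hpos z).le, one_div_mul_cancel hp0.ne', Real.rpow_one]
  have e3 : ∀ z, (ω z ^ (-(1 / p))) ^ q = ω z ^ (-(1 / (p - 1))) := fun z => by
    rw [← Real.rpow_mul (hpos z).le]; congr 1; rw [hq]; field_simp
  simp only [e1, e2, e3] at H
  rw [setIntegral_const, smul_eq_mul, mul_one] at H
  set a := ∫ z in E, ω z
  set s := ∫ z in E, ω z ^ (-(1 / (p - 1)))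
  set W := ∫ z in ball x r, ω z
  set S := ∫ z in ball x r, ω z ^ (-(1 / (p - 1)))
  have ha : 0 ≤ a := integral_nonneg fun z => (hpos z).le
  have hs0 : 0 ≤ s := integral_nonneg fun z => Real.rpow_nonneg (hpos z).le _
  have hW : 0 ≤ W := integral_nonneg fun z => (hpos z).le
  have hsS : s ≤ S := setIntegral_mono_set (contI hs ball_subset_closedBall)
    (Filter.Eventually.of_forall fun z => Real.rpow_nonneg (hpos z).le _) hEB.eventuallyLE
  have hS0 : 0 ≤ S := hs0.trans hsS
  have H2 : (volume.real E) ^ p ≤ a * S ^ (p - 1) := by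
    calc (volume.real E) ^ p ≤ (a ^ (1 / p) * s ^ (1 / q)) ^ p :=
          Real.rpow_le_rpow measureReal_nonneg H hp0.le
      _ = a * s ^ (p - 1) := by
          rw [Real.mul_rpow (by positivity) (by positivity), ← Real.rpow_mul ha,
            ← Real.rpow_mul hs0, one_div_mul_cancel hp0.ne', Real.rpow_one]
          congr 2; rw [hq]; field_simp
      _ ≤ a * S ^ (p - 1) := by gcongr
  have hV : 0 < volume.real (ball x r) :=
    ENNReal.toReal_pos (measure_ball_pos _ _ hr).ne' measure_ball_lt_top.ne
  have H3 := hA x r hr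
  change ((volume.real (ball x r))⁻¹ * W) * ((volume.real (ball x r))⁻¹ * S) ^ (p - 1) ≤ K at H3
  set V := volume.real (ball x r)
  have H4 : W * S ^ (p - 1) ≤ K * V ^ p := by
    rw [Real.mul_rpow (by positivity) hS0, Real.inv_rpow hV.le] at H3
    have : V ^ p = V * V ^ (p - 1) := by
      rw [← Real.rpow_one_add' hV.le (by linarith)]; congr 1; ring
    rw [this]
    have h5 : 0 < V ^ (p - 1) := by positivity
    calc W * S ^ (p - 1) = (V⁻¹ * W * ((V ^ (p - 1))⁻¹ * S ^ (p - 1))) * (V * V ^ (p - 1)) := by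
          field_simp
      _ ≤ _ := by gcongr
  calc volume.real E ^ p * W ≤ (a * S ^ (p - 1)) * W := by gcongr
    _ = a * (W * S ^ (p - 1)) := by ring
    _ ≤ a * (K * V ^ p) := by gcongr
    _ = _ := by ring

lemma volball {n : ℕ} (x : EuclideanSpace ℝ (Fin n)) {r : ℝ} (hr : 0 < r) :
    volume.real (ball x r) = r ^ n * volume.real (ball (0 : EuclideanSpace ℝ (Fin n)) 1) := by
  have := Measure.addHaar_ball_of_pos (volume : Measure (EuclideanSpace ℝ (Fin n))) x hr
  rw [finrank_euclideanSpace_fin] at this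
  simp only [Measure.real, this, ENNReal.toReal_mul]
  rw [ENNReal.toReal_ofReal (by positivity)]

lemma Ap_half {n : ℕ} (hn : 2 ≤ n) {p K : ℝ} (hp : 1 < p) (hK : 1 ≤ K)
    {ω : EuclideanSpace ℝ (Fin n) → ℝ}
    (hpos : ∀ x, 0 < ω x) (hc : Continuous ω) (hA : IsApWeight n p K ω)
    (x : EuclideanSpace ℝ (Fin n)) {r : ℝ} (hr : 0 < r) :
    ∫ z in ball x (r / 2), ω z ≤ (1 - K⁻¹ * (1 / 2) ^ p) * ∫ z in ball x r, ω z := by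
  have hsub : ball x (r / 2) ⊆ ball x r := ball_subset_ball (by linarith)
  have H := Ap_subset hp hpos hc hA x hr (E := ball x r \ ball x (r / 2))
    (measurableSet_ball.diff measurableSet_ball) sdiff_subset
  rw [setIntegral_sdiff measurableSet_ball (contI hc ball_subset_closedBall) hsub] at H
  have hV : 0 < volume.real (ball x r) :=
    ENNReal.toReal_pos (measure_ball_pos _ _ hr).ne' measure_ball_lt_top.ne
  have hvol : (1 / 2) * volume.real (ball x r) ≤ volume.real (ball x r \ ball x (r / 2)) := by
    rw [measureReal_sdiff hsub measurableSet_ball measure_ball_lt_top.ne]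
    have h1 : volume.real (ball x (r / 2)) = (1 / 2) ^ n * volume.real (ball x r) := by
      rw [volball x hr, volball x (half_pos hr)]; ring
    have h2 : ((1 : ℝ) / 2) ^ n ≤ 1 / 2 := by
      calc ((1 : ℝ) / 2) ^ n ≤ (1 / 2) ^ 1 :=
            pow_le_pow_of_le_one (by norm_num) (by norm_num) (by omega)
        _ = _ := pow_one _
    rw [h1]; nlinarith
  set V := volume.real (ball x r)
  set W := ∫ z in ball x r, ω z
  set W' := ∫ z in ball x (r / 2), ω z
  have hW : 0 ≤ W := integral_nonneg fun z => (hpos z).le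
  have hVp : 0 < V ^ p := by positivity
  have H2 : (1 / 2) ^ p * V ^ p * W ≤ K * V ^ p * (W - W') := by
    rw [← Real.mul_rpow (by norm_num) hV.le]
    refine le_trans ?_ H
    gcongr
  have H3 : (1 / 2 : ℝ) ^ p * W ≤ K * (W - W') := by
    refine le_of_mul_le_mul_left ?_ hVp
    linarith
  have H4 : K⁻¹ * (1 / 2 : ℝ) ^ p * W ≤ W - W' := by
    rw [mul_assoc, inv_mul_le_iff₀ (by linarith)]; exact H3
  linarith

lemma Ap_double {n : ℕ} {p K : ℝ} (hp : 1 < p) (hK : 1 ≤ K)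
    {ω : EuclideanSpace ℝ (Fin n) → ℝ}
    (hpos : ∀ x, 0 < ω x) (hc : Continuous ω) (hA : IsApWeight n p K ω)
    (x m : EuclideanSpace ℝ (Fin n)) {r : ℝ} (hr : 0 < r) (hm : dist m x ≤ r / 2) :
    ∫ z in ball x r, ω z ≤ K * (2 ^ n) ^ p * ∫ z in closedBall m (r / 2), ω z := by
  have hsub : ball m (r / 2) ⊆ ball x r := ball_subset_ball' (by linarith)
  have H := Ap_subset hp hpos hc hA x hr (E := ball m (r / 2)) measurableSet_ball hsub
  have hV : 0 < volume.real (ball m (r / 2)) :=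
    ENNReal.toReal_pos (measure_ball_pos _ _ (half_pos hr)).ne' measure_ball_lt_top.ne
  have h1 : volume.real (ball x r) = 2 ^ n * volume.real (ball m (r / 2)) := by
    rw [volball x hr, volball m (half_pos hr), div_pow]; field_simp
  rw [h1, Real.mul_rpow (by positivity) hV.le] at H
  have e : ∫ z in ball m (r / 2), ω z ≤ ∫ z in closedBall m (r / 2), ω z :=
    setIntegral_mono_set (contI hc subset_rfl)
      (Filter.Eventually.of_forall fun z => (hpos z).le) ball_subset_closedBall.eventuallyLE
  have hVp : 0 < volume.real (ball m (r / 2)) ^ p := by positivity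
  have e2 : ∫ z in ball x r, ω z ≤ K * (2 ^ n) ^ p * ∫ z in ball m (r / 2), ω z := by
    refine le_of_mul_le_mul_left ?_ hVp
    linarith
  refine e2.trans ?_
  gcongr

lemma Ap_decay {n : ℕ} (hn : 2 ≤ n) {p K : ℝ} (hp : 1 < p) (hK : 1 ≤ K) :
    ∃ A β : ℝ, 0 < A ∧ 0 < β ∧ ∀ ω : EuclideanSpace ℝ (Fin n) → ℝ,
        (∀ x, 0 < ω x) → Continuous ω → IsApWeight n p K ω →
        ∀ (x : EuclideanSpace ℝ (Fin n)) (R t : ℝ), 0 < R → 0 < t → t ≤ 1 →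
        (∫ z in ball x (t * R), ω z) ^ ((1 : ℝ) / n) ≤
          A * t ^ β * (∫ z in ball x R, ω z) ^ ((1 : ℝ) / n) := by
  set θ : ℝ := 1 - K⁻¹ * (1 / 2) ^ p with hθ
  have hhalf : ((1 : ℝ) / 2) ^ p < 1 := Real.rpow_lt_one (by norm_num) (by norm_num) (by linarith)
  have hhalf0 : 0 < ((1 : ℝ) / 2) ^ p := by positivity
  have hKi : K⁻¹ ≤ 1 := inv_le_one_of_one_le₀ hK
  have hKi0 : 0 < K⁻¹ := by positivity
  have hθ1 : θ < 1 := by have := mul_pos hKi0 hhalf0; linarith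
  have hθ0 : 0 < θ := by nlinarith
  have hn0 : 0 < (1 : ℝ) / n := by positivity
  set β : ℝ := Real.logb (1 / 2) (θ ^ ((1 : ℝ) / n)) with hβ
  have hβe : (1 / 2 : ℝ) ^ β = θ ^ ((1 : ℝ) / n) :=
    Real.rpow_logb (by norm_num) (by norm_num) (by positivity)
  have hβ0 : 0 < β := Real.logb_pos_of_base_lt_one (by norm_num) (by norm_num) (by positivity)
    (Real.rpow_lt_one hθ0.le hθ1 hn0)
  refine ⟨2 ^ β, β, by positivity, hβ0, ?_⟩
  intro ω hpos hc hA x R t hR ht ht1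
  obtain ⟨k, hk1, hk2⟩ := exists_nat_pow_near_of_lt_one ht ht1
    (by norm_num : (0 : ℝ) < 1 / 2) (by norm_num)
  have hiter : ∀ j : ℕ, ∫ z in ball x ((1 / 2) ^ j * R), ω z ≤ θ ^ j * ∫ z in ball x R, ω z := by
    intro j
    induction j with
    | zero => simp
    | succ j ih =>
      have := Ap_half hn hp hK hpos hc hA x (r := (1 / 2) ^ j * R) (by positivity)
      calc ∫ z in ball x ((1 / 2) ^ (j + 1) * R), ω z
          = ∫ z in ball x ((1 / 2) ^ j * R / 2), ω z := by congr 3; ring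
        _ ≤ θ * ∫ z in ball x ((1 / 2) ^ j * R), ω z := this
        _ ≤ θ * (θ ^ j * ∫ z in ball x R, ω z) := by gcongr
        _ = _ := by ring
  have hW : 0 ≤ ∫ z in ball x R, ω z := integral_nonneg fun z => (hpos z).le
  have h1 : ∫ z in ball x (t * R), ω z ≤ θ ^ k * ∫ z in ball x R, ω z := by
    refine le_trans ?_ (hiter k)
    refine setIntegral_mono_set (contI hc ball_subset_closedBall)
      (Filter.Eventually.of_forall fun z => (hpos z).le)
      (ball_subset_ball ?_).eventuallyLE
    gcongr
  calc (∫ z in ball x (t * R), ω z) ^ ((1 : ℝ) / n)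
      ≤ (θ ^ k * ∫ z in ball x R, ω z) ^ ((1 : ℝ) / n) :=
        Real.rpow_le_rpow (integral_nonneg fun z => (hpos z).le) h1 hn0.le
    _ = ((1 / 2 : ℝ) ^ k) ^ β * (∫ z in ball x R, ω z) ^ ((1 : ℝ) / n) := by
        rw [Real.mul_rpow (by positivity) hW]
        congr 1
        rw [← Real.rpow_natCast θ, ← Real.rpow_natCast (1 / 2 : ℝ), ← Real.rpow_mul hθ0.le,
          mul_comm, Real.rpow_mul hθ0.le, ← hβe, ← Real.rpow_mul (by norm_num),
          ← Real.rpow_mul (by norm_num), mul_comm β]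
    _ ≤ (2 * t) ^ β * (∫ z in ball x R, ω z) ^ ((1 : ℝ) / n) := by
        gcongr
        rw [pow_succ] at hk1; linarith
    _ = _ := by rw [Real.mul_rpow (by norm_num) ht.le]

lemma scale_int {n : ℕ} {ω : EuclideanSpace ℝ (Fin n) → ℝ}
    (hpos : ∀ x, 0 < ω x) (hc : Continuous ω) (x m : EuclideanSpace ℝ (Fin n)) {R t : ℝ}
    (hR : 0 < R) (ht : 0 < t) (hm : dist m x ≤ R / 2) :
    ∫ z in closedBall m (R / 4), ω (x + t • (z - x)) ≤
      (t ^ n)⁻¹ * ∫ z in ball x (t * R), ω z := by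
  have e : ∀ z, ω (x + t • (z - x)) = (fun w => ω (w + (x - t • x))) (t • z) := fun z => by
    simp only; congr 1; rw [smul_sub]; abel
  simp_rw [e]
  rw [Measure.setIntegral_comp_smul volume (fun w => ω (w + (x - t • x))) _ ht.ne',
    finrank_euclideanSpace_fin, abs_of_pos (by positivity), smul_eq_mul]
  gcongr
  rw [← (measurePreserving_add_right volume (x - t • x)).setIntegral_preimage_emb
    (measurableEmbedding_addRight _) ω]
  refine setIntegral_mono_set ?_ (Filter.Eventually.of_forall fun z => (hpos _).le)
      (LE.le.eventuallyLE ?_)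
  · refine contI (x := t • x) (r := t * R) (hc.comp (by fun_prop)) ?_
    intro w hw
    simp only [mem_preimage, mem_ball, mem_closedBall, dist_eq_norm] at hw ⊢
    refine le_trans (le_of_eq ?_) hw.le
    congr 1; abel
  · rintro _ ⟨z, hz, rfl⟩
    simp only [mem_preimage, mem_ball, mem_closedBall] at hz ⊢
    have h1 : dist z x < R := by
      have := dist_triangle z m x
      linarith
    rw [dist_eq_norm] at *
    have : t • z + (x - t • x) - x = t • (z - x) := by rw [smul_sub]; abel
    rw [this, norm_smul, Real.norm_of_nonneg ht.le]
    gcongr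

lemma key_avg {n : ℕ} (hn : 2 ≤ n) {A β : ℝ} (hA0 : 0 < A) (hβ : 0 < β)
    {ω : EuclideanSpace ℝ (Fin n) → ℝ}
    (hpos : ∀ x, 0 < ω x) (hc : Continuous ω) (x m : EuclideanSpace ℝ (Fin n)) {R : ℝ}
    (hR : 0 < R) (hm : dist m x ≤ R / 2)
    (hdec : ∀ t, 0 < t → t ≤ 1 → (∫ z in ball x (t * R), ω z) ^ ((1 : ℝ) / n) ≤
          A * t ^ β * (∫ z in ball x R, ω z) ^ ((1 : ℝ) / n)) :
    ∫ z in closedBall m (R / 4), ∫ t in (0 : ℝ)..1, ω (x + t • (z - x)) ^ ((1 : ℝ) / n) ≤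
      volume.real (closedBall m (R / 4)) * ((A / β) *
        ((volume.real (closedBall m (R / 4)))⁻¹) ^ ((1 : ℝ) / n) *
          (∫ z in ball x R, ω z) ^ ((1 : ℝ) / n)) := by
  have hn0 : 0 < (1 : ℝ) / n := by positivity
  have hn1 : (1 : ℝ) / n ≤ 1 := by
    rw [div_le_one (by positivity)]; exact_mod_cast (by omega : 1 ≤ n)
  have hjoint : Continuous fun q : ℝ × EuclideanSpace ℝ (Fin n) =>
      ω (x + q.1 • (q.2 - x)) ^ ((1 : ℝ) / n) :=
    (hc.comp (by fun_prop)).rpow_const fun z => Or.inl (hpos _).ne'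
  have hVpos : 0 < volume (closedBall m (R / 4)) := measure_closedBall_pos _ _ (by positivity)
  have hVfin : volume (closedBall m (R / 4)) < ∞ := measure_closedBall_lt_top
  have hV : 0 < volume.real (closedBall m (R / 4)) := ENNReal.toReal_pos hVpos.ne' hVfin.ne
  rw [← intervalIntegral_integral_swap
    (f := fun t z => ω (x + t • (z - x)) ^ ((1 : ℝ) / n))]
  swap
  · rw [Measure.prod_restrict]
    have : IntegrableOn (fun q : ℝ × EuclideanSpace ℝ (Fin n) =>
      ω (x + q.1 • (q.2 - x)) ^ ((1 : ℝ) / n)) (Icc 0 1 ×ˢ closedBall m (R / 4))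
        (volume.prod volume) :=
      hjoint.continuousOn.integrableOn_compact (isCompact_Icc.prod (isCompact_closedBall _ _))
    refine this.mono_set (prod_mono ?_ subset_rfl)
    rw [uIoc_of_le zero_le_one]
    exact Ioc_subset_Icc_self
  have hpt : ∀ t ∈ Ioo (0 : ℝ) 1,
      ∫ z in closedBall m (R / 4), ω (x + t • (z - x)) ^ ((1 : ℝ) / n) ≤
      (volume.real (closedBall m (R / 4)) * (A *
        ((volume.real (closedBall m (R / 4)))⁻¹) ^ ((1 : ℝ) / n) *
          (∫ z in ball x R, ω z) ^ ((1 : ℝ) / n))) * t ^ (β - 1) := by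
    intro t ht
    have ht0 : 0 < t := ht.1
    have hcont : Continuous fun z => ω (x + t • (z - x)) := hc.comp (by fun_prop)
    have J := (Real.concaveOn_rpow hn0.le hn1).le_map_set_average (μ := volume)
      (t := closedBall m (R / 4)) (f := fun z => ω (x + t • (z - x)))
      (Continuous.continuousOn (Real.continuous_rpow_const hn0.le)) isClosed_Ici hVpos.ne' hVfin.ne
      (Filter.Eventually.of_forall fun z => (hpos _).le) (contI hcont subset_rfl)
      (contI (hcont.rpow_const fun z => Or.inl (hpos _).ne') subset_rfl)
    simp only [setAverage_eq, smul_eq_mul] at J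
    rw [inv_mul_le_iff₀ hV] at J
    refine J.trans ?_
    rw [mul_assoc (volume.real _)]
    refine mul_le_mul_of_nonneg_left ?_ hV.le
    have S := scale_int hpos hc x m hR ht0 hm
    set v := (volume.real (closedBall m (R / 4)))⁻¹
    have hv : 0 ≤ v := by positivity
    have hWt : 0 ≤ ∫ z in ball x (t * R), ω z := integral_nonneg fun z => (hpos z).le
    have ht' : ((t ^ n)⁻¹ : ℝ) ^ ((1 : ℝ) / n) = t⁻¹ := by
      rw [← inv_pow, one_div]
      exact Real.pow_rpow_inv_natCast (by positivity) (by omega)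
    calc (v * ∫ z in closedBall m (R / 4), ω (x + t • (z - x))) ^ ((1 : ℝ) / n)
        ≤ (v * ((t ^ n)⁻¹ * ∫ z in ball x (t * R), ω z)) ^ ((1 : ℝ) / n) := by
          refine Real.rpow_le_rpow (mul_nonneg hv (integral_nonneg fun z => (hpos _).le)) ?_ hn0.le
          gcongr
      _ = v ^ ((1 : ℝ) / n) * (t⁻¹ * (∫ z in ball x (t * R), ω z) ^ ((1 : ℝ) / n)) := by
          rw [Real.mul_rpow hv (by positivity), Real.mul_rpow (by positivity) hWt, ht']
      _ ≤ v ^ ((1 : ℝ) / n) *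
          (t⁻¹ * (A * t ^ β * (∫ z in ball x R, ω z) ^ ((1 : ℝ) / n))) := by
          gcongr
          exact hdec t ht0 ht.2.le
      _ = _ := by
          rw [Real.rpow_sub_one ht0.ne']
          field_simp
  have hI2 : IntervalIntegrable (fun t : ℝ =>
      (volume.real (closedBall m (R / 4)) * (A *
        ((volume.real (closedBall m (R / 4)))⁻¹) ^ ((1 : ℝ) / n) *
          (∫ z in ball x R, ω z) ^ ((1 : ℝ) / n))) * t ^ (β - 1)) volume 0 1 :=
    (intervalIntegral.intervalIntegrable_rpow' (by linarith)).const_mul _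
  have hI1 : IntervalIntegrable (fun t : ℝ =>
      ∫ z in closedBall m (R / 4), ω (x + t • (z - x)) ^ ((1 : ℝ) / n)) volume 0 1 := by
    apply Continuous.intervalIntegrable
    exact continuous_parametric_integral_of_continuous
      (f := fun t z => ω (x + t • (z - x)) ^ ((1 : ℝ) / n)) hjoint (isCompact_closedBall _ _)
  refine (intervalIntegral.integral_mono_on_of_le_Ioo zero_le_one hI1 hI2 hpt).trans ?_
  rw [intervalIntegral.integral_const_mul, integral_rpow (Or.inl (by linarith))]
  simp only [sub_add_cancel, Real.one_rpow, Real.zero_rpow hβ.ne', sub_zero]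
  apply le_of_eq
  ring

lemma dW_bdd {n : ℕ} {ω : EuclideanSpace ℝ (Fin n) → ℝ}
    (hpos : ∀ x, 0 < ω x) (x y : EuclideanSpace ℝ (Fin n)) :
    BddBelow {d : ℝ | ∃ (L : ℝ) (γ : ℝ → EuclideanSpace ℝ (Fin n)),
    0 ≤ L ∧ LipschitzOnWith 1 γ (Set.Icc 0 L) ∧ γ 0 = x ∧ γ L = y ∧
    (∀ t ∈ Set.Icc 0 L, γ t ∈ closedBall (midpoint ℝ x y) (dist x y / 2)) ∧
    d = ∫ t in (0 : ℝ)..L, (ω (γ t)) ^ ((1 : ℝ) / n)} := by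
  refine ⟨0, ?_⟩
  rintro d ⟨L, γ, hL, -, -, -, -, rfl⟩
  exact intervalIntegral.integral_nonneg hL fun t _ => Real.rpow_nonneg (hpos _).le _

lemma dW_le_curve {n : ℕ} {ω : EuclideanSpace ℝ (Fin n) → ℝ}
    (hpos : ∀ x, 0 < ω x) (hc : Continuous ω) (x y z : EuclideanSpace ℝ (Fin n)) (hxy : x ≠ y)
    (hz : z ∈ closedBall (midpoint ℝ x y) (dist x y / 4)) :
    dW n ω x y ≤ dist x y * (∫ t in (0 : ℝ)..1, ω (x + t • (z - x)) ^ ((1 : ℝ) / n)) +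
      dist x y * (∫ t in (0 : ℝ)..1, ω (y + t • (z - y)) ^ ((1 : ℝ) / n)) := by
  set R := dist x y with hRdef
  have hR : 0 < R := dist_pos.2 hxy
  have hxm : dist x (midpoint ℝ x y) = R / 2 := by
    rw [dist_left_midpoint]; simp; ring
  have hym : dist y (midpoint ℝ x y) = R / 2 := by
    rw [dist_right_midpoint]; simp; ring
  have hzm := mem_closedBall.1 hz
  have hzx : ‖z - x‖ ≤ R := by
    rw [← dist_eq_norm]
    have := dist_triangle_right z x (midpoint ℝ x y); linarith
  have hyz : ‖y - z‖ ≤ R := by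
    rw [← dist_eq_norm]
    have := dist_triangle_right y z (midpoint ℝ x y); linarith
  set γ : ℝ → EuclideanSpace ℝ (Fin n) :=
    fun s => x + min (s / R) 1 • (z - x) + max (s / R - 1) 0 • (y - z) with hγ
  have hγc : Continuous γ := by
    simp only [hγ]; fun_prop
  have g1 : ∀ s ≤ R, γ s = x + (s / R) • (z - x) := fun s hs => by
    have : s / R ≤ 1 := (div_le_one hR).2 hs
    simp only [hγ]
    rw [min_eq_left this, max_eq_right (by linarith)]; simp
  have g2 : ∀ s, R ≤ s → γ s = y + (2 - s / R) • (z - y) := fun s hs => by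
    have : 1 ≤ s / R := (one_le_div hR).2 hs
    simp only [hγ]
    rw [min_eq_right this, max_eq_left (by linarith)]
    module
  have hconv := convex_closedBall (midpoint ℝ x y) (R / 2)
  have mx : x ∈ closedBall (midpoint ℝ x y) (R / 2) := by rw [mem_closedBall, hxm]
  have my : y ∈ closedBall (midpoint ℝ x y) (R / 2) := by rw [mem_closedBall, hym]
  have mz : z ∈ closedBall (midpoint ℝ x y) (R / 2) := by rw [mem_closedBall]; linarith
  refine csInf_le (dW_bdd hpos x y) ⟨2 * R, γ, by positivity, ?_, ?_, ?_, ?_, ?_⟩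
  · apply LipschitzOnWith.of_dist_le_mul
    intro s _ s' _
    simp only [NNReal.coe_one, one_mul]
    have e : γ s - γ s' = (min (s / R) 1 - min (s' / R) 1) • (z - x) +
        (max (s / R - 1) 0 - max (s' / R - 1) 0) • (y - z) := by
      simp only [hγ]; module
    rw [dist_eq_norm, e]
    have hab : ∀ a b : ℝ, |min a 1 - min b 1| + |max (a - 1) 0 - max (b - 1) 0| ≤ |a - b| := by
      intro a b
      rcases le_total a 1 with ha | ha <;> rcases le_total b 1 with hb | hb
      · rw [min_eq_left ha, min_eq_left hb, max_eq_right (by linarith), max_eq_right (by linarith)]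
        simp
      · rw [min_eq_left ha, min_eq_right hb, max_eq_right (by linarith), max_eq_left (by linarith),
          abs_of_nonpos (by linarith), abs_of_nonpos (by linarith), abs_of_nonpos (by linarith)]
        linarith
      · rw [min_eq_right ha, min_eq_left hb, max_eq_left (by linarith), max_eq_right (by linarith),
          abs_of_nonneg (by linarith), abs_of_nonneg (by linarith), abs_of_nonneg (by linarith)]
        linarith
      · rw [min_eq_right ha, min_eq_right hb, max_eq_left (by linarith), max_eq_left (by linarith)]
        simp
    calc _ ≤ |min (s / R) 1 - min (s' / R) 1| * ‖z - x‖ +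
          |max (s / R - 1) 0 - max (s' / R - 1) 0| * ‖y - z‖ := by
          refine (norm_add_le _ _).trans ?_
          rw [norm_smul, norm_smul, Real.norm_eq_abs, Real.norm_eq_abs]
      _ ≤ |min (s / R) 1 - min (s' / R) 1| * R +
          |max (s / R - 1) 0 - max (s' / R - 1) 0| * R := by gcongr
      _ ≤ |s / R - s' / R| * R := by
          rw [← add_mul]; gcongr; exact hab _ _
      _ = dist s s' := by
          rw [← sub_div, abs_div, abs_of_pos hR, Real.dist_eq]; field_simp
  · rw [g1 0 hR.le]; simp
  · rw [g2 (2 * R) (by linarith)]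
    have : 2 - 2 * R / R = 0 := by field_simp; ring
    rw [this]; simp
  · intro s hs
    rcases le_total s R with h | h
    · rw [g1 s h]
      exact hconv.add_smul_sub_mem mx mz ⟨div_nonneg hs.1 hR.le, (div_le_one hR).2 h⟩
    · rw [g2 s h]
      refine hconv.add_smul_sub_mem my mz ⟨?_, ?_⟩
      · have : s / R ≤ 2 := (div_le_iff₀ hR).2 hs.2
        linarith
      · have : 1 ≤ s / R := (one_le_div hR).2 h
        linarith
  · have hcont : Continuous fun t => ω (γ t) ^ ((1 : ℝ) / n) :=
      (hc.comp hγc).rpow_const fun z => Or.inl (hpos _).ne'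
    rw [← intervalIntegral.integral_add_adjacent_intervals (b := R)
      (hcont.intervalIntegrable _ _) (hcont.intervalIntegrable _ _)]
    congr 1
    · rw [intervalIntegral.integral_congr (a := 0) (b := R)
        (f := fun t => ω (γ t) ^ ((1 : ℝ) / n))
        (g := fun s => (fun t => ω (x + t • (z - x)) ^ ((1 : ℝ) / n)) (s / R))]
      · rw [intervalIntegral.integral_comp_div
          (fun t => ω (x + t • (z - x)) ^ ((1 : ℝ) / n)) hR.ne', div_self hR.ne', zero_div, smul_eq_mul]
      · intro s hs
        rw [uIcc_of_le hR.le] at hs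
        simp only [g1 s hs.2]
    · rw [intervalIntegral.integral_congr (a := R) (b := 2 * R)
        (f := fun t => ω (γ t) ^ ((1 : ℝ) / n))
        (g := fun s => (fun t => ω (y + t • (z - y)) ^ ((1 : ℝ) / n)) (2 - s / R))]
      · rw [intervalIntegral.integral_comp_sub_div
          (fun t => ω (y + t • (z - y)) ^ ((1 : ℝ) / n)) hR.ne', div_self hR.ne', smul_eq_mul]
        have : 2 - 2 * R / R = 0 := by field_simp; ring
        rw [this]; norm_num
      · intro s hs
        rw [uIcc_of_le (by linarith)] at hs
        simp only [g2 s hs.1]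
/-- If `ω` is a positive continuous `A_p` weight with constant
`K`, then `d_ω ≤ C δ_ω` for a constant `C` depending only on `n`, `p` and `K`. -/
theorem dW_le_deltaW_of_Ap
    (n : ℕ) (hn : 2 ≤ n) (p K : ℝ) (hp : 1 < p) :
    ∃ C : ℝ, 0 < C ∧
      ∀ ω : EuclideanSpace ℝ (Fin n) → ℝ,
        (∀ x, 0 < ω x) → Continuous ω → IsApWeight n p K ω →
        ∀ x y : EuclideanSpace ℝ (Fin n),
          dW n ω x y ≤ C * deltaW n ω x y := by
  set K' : ℝ := max K 1 with hK'
  have hK1 : 1 ≤ K' := le_max_right _ _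
  obtain ⟨A, β, hA0, hβ, hdec⟩ := Ap_decay hn hp hK1
  set v : ℝ := volume.real (ball (0 : EuclideanSpace ℝ (Fin n)) 1) with hv
  have hv0 : 0 < v :=
    ENNReal.toReal_pos (measure_ball_pos _ _ one_pos).ne' measure_ball_lt_top.ne
  have hn0 : 0 < (1 : ℝ) / n := by positivity
  set M : ℝ := K' * (2 ^ n) ^ p with hM
  have hM0 : 0 < M := by positivity
  refine ⟨2 * (A / β * (4 * v⁻¹ ^ ((1 : ℝ) / n)) * M ^ ((1 : ℝ) / n)), by positivity, ?_⟩
  intro ω hpos hc hAp x y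
  have hAp' : IsApWeight n p K' ω := fun z r hr => (hAp z r hr).trans (le_max_left _ _)
  have hδ0 : 0 ≤ ∫ z in closedBall (midpoint ℝ x y) (dist x y / 2), ω z :=
    integral_nonneg fun z => (hpos z).le
  rcases eq_or_ne x y with rfl | hxy
  · refine le_trans (csInf_le (dW_bdd hpos x x) ⟨0, fun _ => x, le_rfl, ?_, rfl, rfl, ?_, ?_⟩)
      (b := 0) ?_
    · exact (LipschitzWith.const' x).lipschitzOnWith
    · intro t _; simp
    · simp
    · unfold deltaW; positivity
  set R := dist x y with hRdef
  have hR : 0 < R := dist_pos.2 hxy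
  set m := midpoint ℝ x y with hm
  have hmx : dist m x ≤ R / 2 := by
    rw [hm, dist_midpoint_left]; simp; linarith
  have hmy : dist m y ≤ R / 2 := by
    rw [hm, dist_midpoint_right]; simp; linarith
  have kx := key_avg hn hA0 hβ hpos hc x m hR hmx (fun t h1 h2 => hdec ω hpos hc hAp' x R t hR h1 h2)
  have ky := key_avg hn hA0 hβ hpos hc y m hR hmy (fun t h1 h2 => hdec ω hpos hc hAp' y R t hR h1 h2)
  have dx := Ap_double hp hK1 hpos hc hAp' x m hR hmx
  have dy := Ap_double hp hK1 hpos hc hAp' y m hR hmy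
  have rx : (∫ z in ball x R, ω z) ^ ((1 : ℝ) / n) ≤ M ^ ((1 : ℝ) / n) * deltaW n ω x y := by
    unfold deltaW
    rw [← Real.mul_rpow hM0.le hδ0]
    exact Real.rpow_le_rpow (integral_nonneg fun z => (hpos z).le) dx hn0.le
  have ry : (∫ z in ball y R, ω z) ^ ((1 : ℝ) / n) ≤ M ^ ((1 : ℝ) / n) * deltaW n ω x y := by
    unfold deltaW
    rw [← Real.mul_rpow hM0.le hδ0]
    exact Real.rpow_le_rpow (integral_nonneg fun z => (hpos z).le) dy hn0.le
  have hvol : volume.real (closedBall m (R / 4)) = (R / 4) ^ n * v := by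
    rw [Measure.addHaar_real_closedBall volume m (by positivity), finrank_euclideanSpace_fin]
  have hvr : ((volume.real (closedBall m (R / 4)))⁻¹) ^ ((1 : ℝ) / n) =
      R⁻¹ * (4 * v⁻¹ ^ ((1 : ℝ) / n)) := by
    rw [hvol, mul_inv, Real.mul_rpow (by positivity) (by positivity), ← inv_pow]
    have : (((R / 4)⁻¹) ^ n) ^ ((1 : ℝ) / n) = (R / 4)⁻¹ := by
      rw [one_div]
      exact Real.pow_rpow_inv_natCast (by positivity) (by omega)
    rw [this, inv_div]; ring
  rw [hvr] at kx ky
  have hV : 0 < volume.real (closedBall m (R / 4)) := by rw [hvol]; positivity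
  have hcF : ∀ a : EuclideanSpace ℝ (Fin n), Continuous fun z =>
      ∫ t in (0 : ℝ)..1, ω (a + t • (z - a)) ^ ((1 : ℝ) / n) := fun a =>
    intervalIntegral.continuous_parametric_intervalIntegral_of_continuous'
      (f := fun z t => ω (a + t • (z - a)) ^ ((1 : ℝ) / n))
      ((hc.comp (by fun_prop)).rpow_const fun z => Or.inl (hpos _).ne') 0 1
  have hle : ∫ _ in closedBall m (R / 4), dW n ω x y ≤ ∫ z in closedBall m (R / 4),
      (R * (∫ t in (0 : ℝ)..1, ω (x + t • (z - x)) ^ ((1 : ℝ) / n)) +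
      R * (∫ t in (0 : ℝ)..1, ω (y + t • (z - y)) ^ ((1 : ℝ) / n))) := by
    refine setIntegral_mono_on (contI continuous_const subset_rfl)
      (contI (((hcF x).const_mul R).add ((hcF y).const_mul R)) subset_rfl)
      measurableSet_closedBall ?_
    intro z hz
    exact dW_le_curve hpos hc x y z hxy hz
  rw [setIntegral_const, smul_eq_mul,
    integral_add (contI ((hcF x).const_mul R) subset_rfl) (contI ((hcF y).const_mul R) subset_rfl),
    integral_const_mul, integral_const_mul] at hle
  refine le_of_mul_le_mul_left ?_ hV
  set V := volume.real (closedBall m (R / 4))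
  set c := 4 * v⁻¹ ^ ((1 : ℝ) / n) with hcc
  have hc0 : 0 < c := by positivity
  calc V * dW n ω x y ≤ _ := hle
    _ ≤ R * (V * (A / β * (R⁻¹ * c) * (M ^ ((1 : ℝ) / n) * deltaW n ω x y))) +
        R * (V * (A / β * (R⁻¹ * c) * (M ^ ((1 : ℝ) / n) * deltaW n ω x y))) := by
        refine add_le_add (mul_le_mul_of_nonneg_left (kx.trans ?_) hR.le)
          (mul_le_mul_of_nonneg_left (ky.trans ?_) hR.le)
        · gcongr
        · gcongr
    _ = _ := by field_simp; ring
end
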